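/- Let Γ be the group with presentation ⟨a, b, x, y | x² = y² = x·y·[a,b] = 1⟩, where [a,b] = a b a⁻¹ b⁻¹. Then there is no surjective group homomorphism μ : Γ → Q₈ onto the quaternion group of order 8 such that μ(x) ≠ 1 and μ(y) ≠ 1. (This is the argument excluding quaternion actions on a genus-5 curve with elliptic quotient branched over two points: since Q₈ has a unique element of order 2, such μ would send x and y to −1, forcing [μ(a), μ(b)] = 1 and making the image abelian.) -/

import Mathlib

/-- The relations of the orbifold group `Γ = ⟨a, b, x, y ∣ x² = y² = x·y·[a,b] = 1⟩`,
with generators `a = 0`, `b = 1`, `x = 2`, `y = 3`. -/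
def orbifoldRels : Set (FreeGroup (Fin 4)) :=
  { FreeGroup.of 2 ^ 2, FreeGroup.of 3 ^ 2,
    FreeGroup.of 2 * FreeGroup.of 3 *
      (FreeGroup.of 0 * FreeGroup.of 1 * (FreeGroup.of 0)⁻¹ * (FreeGroup.of 1)⁻¹) }

theorem q8_involution (g : QuaternionGroup 2) (h : g ^ 2 = 1) (h1 : g ≠ 1) :
    g = QuaternionGroup.a 2 := by
  revert g
  decide

theorem q8_central (g : QuaternionGroup 2) :
    Commute (QuaternionGroup.a 2) g := by
  change _ * _ = _ * _
  revert g
  decide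

/-- There is no surjective homomorphism `μ` from
`Γ = ⟨a, b, x, y ∣ x² = y² = x·y·[a,b] = 1⟩` onto the quaternion group `Q₈` of order 8
with `μ(x) ≠ 1` and `μ(y) ≠ 1`. -/
theorem no_quaternion_quotient :
    ¬ ∃ μ : PresentedGroup orbifoldRels →* QuaternionGroup 2,
      Function.Surjective μ ∧
      μ (PresentedGroup.of 2) ≠ 1 ∧ μ (PresentedGroup.of 3) ≠ 1 := by
  rintro ⟨μ, hs, hx, hy⟩
  have r : ∀ w ∈ orbifoldRels, μ (PresentedGroup.mk orbifoldRels w) = 1 := by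
    intro w hw
    rw [PresentedGroup.one_of_mem hw, map_one]
  have r1 : μ (PresentedGroup.of 2) ^ 2 = 1 := by
    have := r (FreeGroup.of 2 ^ 2) (by simp [orbifoldRels])
    rwa [map_pow, map_pow] at this
  have r2 : μ (PresentedGroup.of 3) ^ 2 = 1 := by
    have := r (FreeGroup.of 3 ^ 2) (by simp [orbifoldRels])
    rwa [map_pow, map_pow] at this
  have r3 := r (FreeGroup.of 2 * FreeGroup.of 3 *
      (FreeGroup.of 0 * FreeGroup.of 1 * (FreeGroup.of 0)⁻¹ * (FreeGroup.of 1)⁻¹))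
      (by simp [orbifoldRels])
  simp only [map_mul, map_inv] at r3
  change μ (PresentedGroup.of 2) * μ (PresentedGroup.of 3) *
    (μ (PresentedGroup.of 0) * μ (PresentedGroup.of 1) * (μ (PresentedGroup.of 0))⁻¹ *
      (μ (PresentedGroup.of 1))⁻¹) = 1 at r3
  have e2 := q8_involution _ r1 hx
  have e3 := q8_involution _ r2 hy
  rw [e3, ← e2, ← sq, r1, one_mul, mul_inv_eq_one, mul_inv_eq_iff_eq_mul] at r3
  have c01 : Commute (μ (PresentedGroup.of 0)) (μ (PresentedGroup.of 1)) := r3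
  have hc : ∀ i j : Fin 4, Commute (μ (PresentedGroup.of i)) (μ (PresentedGroup.of j)) := by
    intro i j
    fin_cases i <;> fin_cases j <;>
    first
      | exact Commute.refl _
      | exact c01
      | exact c01.symm
      | exact e2 ▸ q8_central _
      | exact e3 ▸ q8_central _
      | exact (e2 ▸ q8_central _ : Commute (μ (PresentedGroup.of 2)) _).symm
      | exact (e3 ▸ q8_central _ : Commute (μ (PresentedGroup.of 3)) _).symm
  -- an element commuting with the images of all generators is central
  have key : ∀ z : QuaternionGroup 2, (∀ i : Fin 4, Commute z (μ (PresentedGroup.of i))) →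
      ∀ g, Commute z (μ g) := by
    intro z hz g
    have hg : g ∈ Subgroup.closure (Set.range (PresentedGroup.of (rels := orbifoldRels))) := by
      rw [PresentedGroup.closure_range_of]; trivial
    induction hg using Subgroup.closure_induction with
    | mem x hx => obtain ⟨i, rfl⟩ := hx; exact hz i
    | one => rw [map_one]; exact Commute.one_right z
    | mul x y _ _ hx hy => rw [map_mul]; exact hx.mul_right hy
    | inv x _ hx => rw [map_inv]; exact hx.inv_right
  have all : ∀ g h, Commute (μ g) (μ h) := fun g h =>
    key _ (fun i => (key _ (hc i) g).symm) h
  obtain ⟨g, hg⟩ := hs (QuaternionGroup.a 1)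
  obtain ⟨k, hk⟩ := hs (QuaternionGroup.xa 0)
  have := all g k
  rw [hg, hk] at this
  exact absurd this.eq (by decide)
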